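/- arXiv:1609.03658 — 3 statements merged into one kernel-verified Lean document; each statement's English description precedes it below -/
import Mathlib

section
/- Let (ε_i)_{i∈ℕ} be a nonincreasing sequence of positive reals with ε_i → 0, let ρ > 0, and let (a_{i,j})_{i,j∈ℕ} be complex numbers with ∑_{i,j} |a_{i,j}|·ρ^j·ε_i^i < ∞. Then for every 0 < r < ρ and every c > 0, the triple series ∑_{i,p,q∈ℕ} |a_{i,p+q}|·C(p+q,p)·r^p·c^q·ε_{i+q}^{i+q} is finite, where C(p+q,p) is the binomial coefficient. (This states that a power series ∑_{i,j} a_{i,j} x^j t^i with ‖t^i‖ = ε_i^i remains norm-convergent, at the same level h and for every smaller radius r < ρ, after the coordinate change x = w + c·t; it is the estimate used to achieve t-regularity by a generic linear change of coordinates.) -/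
open scoped ENNReal
open Filter

/-- Summing the binomial expansion of `(x + y) ^ n` against arbitrary weights `f n`. -/
theorem ENNReal.tsum_mul_choose_mul_pow_mul_pow (f : ℕ → ℝ≥0∞) (x y : ℝ≥0∞) :
    ∑' p : ℕ × ℕ, f (p.1 + p.2) * (((p.1 + p.2).choose p.1 : ℝ≥0∞) * (x ^ p.1 * y ^ p.2)) =
      ∑' n, f n * (x + y) ^ n := by
  rw [← Finset.HasAntidiagonal.sigmaAntidiagonalEquivProd.tsum_eq, ENNReal.tsum_sigma']
  refine tsum_congr fun n => ?_
  rw [(Commute.all x y).add_pow', Finset.mul_sum, ← Finset.tsum_subtype]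
  refine tsum_congr fun p => ?_
  have hp : p.1.1 + p.1.2 = n := Finset.HasAntidiagonal.mem_antidiagonal.mp p.2
  simp [hp, nsmul_eq_mul]

/-- If `u → 0`, then `u n ^ n` is dominated by every geometric sequence of positive ratio. -/
theorem exists_forall_mul_pow_le_mul_pow {u : ℕ → ℝ} (hu : ∀ n, 0 ≤ u n)
    (hlim : Tendsto u atTop (nhds 0)) {c s : ℝ} (hc : 0 ≤ c) (hs : 0 < s) :
    ∃ M : ℝ, 0 ≤ M ∧ ∀ n, c ^ n * u n ^ n ≤ M * s ^ n := by
  have hlim' : Tendsto (fun n => c * u n / s) atTop (nhds 0) := by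
    simpa using (hlim.const_mul c).div_const s
  have hbdd : IsBoundedUnder (· ≤ ·) atTop fun n => (c * u n / s) ^ n := by
    refine ⟨1, eventually_map.mpr ?_⟩
    filter_upwards [hlim'.eventually_le_const zero_lt_one] with n hn
    exact pow_le_one₀ (div_nonneg (mul_nonneg hc (hu n)) hs.le) hn
  obtain ⟨M, hM⟩ := hbdd.bddAbove_range
  have hM' : ∀ n, (c * u n / s) ^ n ≤ M := fun n => hM ⟨n, rfl⟩
  refine ⟨M, le_trans (by simp) (hM' 0), fun n => ?_⟩
  have := hM' n
  rwa [div_pow, div_le_iff₀ (pow_pos hs n), mul_pow] at this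

/-- The powers `u n ^ n` of an antitone nonnegative sequence are submultiplicative. -/
theorem Antitone.pow_add_le_mul_pow {u : ℕ → ℝ} (hmono : Antitone u) (hu : ∀ n, 0 ≤ u n)
    (m n : ℕ) : u (m + n) ^ (m + n) ≤ u m ^ m * u n ^ n := by
  rw [pow_add]
  exact mul_le_mul (pow_le_pow_left₀ (hu _) (hmono (Nat.le_add_right m n)) m)
    (pow_le_pow_left₀ (hu _) (hmono (Nat.le_add_left n m)) n) (pow_nonneg (hu _) n)
    (pow_nonneg (hu _) m)

/-- The coordinate-change estimate used to achieve `t`-regularity: if `(εᵢ)` is a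
nonincreasing positive sequence tending to `0`, `ρ > 0`, and
`∑_{i,j} |a_{i,j}|·ρʲ·εᵢⁱ < ∞`, then for every `0 < r < ρ` and `c > 0` the triple
series `∑_{i,p,q} |a_{i,p+q}|·C(p+q,p)·rᵖ·c^q·ε_{i+q}^{i+q}` is finite. -/
theorem stmt8 (ε : ℕ → ℝ) (hε : ∀ i, 0 < ε i) (hmono : Antitone ε)
    (hlim : Tendsto ε atTop (nhds 0)) (ρ : ℝ) (hρ : 0 < ρ) (a : ℕ → ℕ → ℂ)
    (hsum : ∑' p : ℕ × ℕ,
        (‖a p.1 p.2‖₊ : ℝ≥0∞) * ENNReal.ofReal (ρ ^ p.2) *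
          ENNReal.ofReal (ε p.1 ^ p.1) < ⊤) :
    ∀ r c : ℝ, 0 < r → r < ρ → 0 < c →
      ∑' p : ℕ × ℕ × ℕ,
          (‖a p.1 (p.2.1 + p.2.2)‖₊ : ℝ≥0∞) *
            (Nat.choose (p.2.1 + p.2.2) p.2.1 : ℝ≥0∞) *
            ENNReal.ofReal (r ^ p.2.1) * ENNReal.ofReal (c ^ p.2.2) *
            ENNReal.ofReal (ε (p.1 + p.2.2) ^ (p.1 + p.2.2)) < ⊤ := by
  intro r c hr hrρ hc
  have hs : 0 < ρ - r := sub_pos.mpr hrρ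
  have hε' : ∀ n, 0 ≤ ε n := fun n => (hε n).le
  obtain ⟨M, hM0, hM⟩ := exists_forall_mul_pow_le_mul_pow hε' hlim hc.le hs
  have hadd : ENNReal.ofReal r + ENNReal.ofReal (ρ - r) = ENNReal.ofReal ρ := by
    rw [← ENNReal.ofReal_add hr.le hs.le, add_sub_cancel]
  have hterm : ∀ i q : ℕ, ENNReal.ofReal (c ^ q) * ENNReal.ofReal (ε (i + q) ^ (i + q)) ≤
      ENNReal.ofReal M * ENNReal.ofReal (ε i ^ i) * ENNReal.ofReal (ρ - r) ^ q := by
    intro i q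
    rw [← ENNReal.ofReal_pow hs.le, ← ENNReal.ofReal_mul (pow_nonneg hc.le q),
      ← ENNReal.ofReal_mul hM0, ← ENNReal.ofReal_mul (mul_nonneg hM0 (pow_nonneg (hε' i) i))]
    refine ENNReal.ofReal_le_ofReal ?_
    calc c ^ q * ε (i + q) ^ (i + q)
        ≤ c ^ q * (ε i ^ i * ε q ^ q) :=
          mul_le_mul_of_nonneg_left (hmono.pow_add_le_mul_pow hε' i q) (pow_nonneg hc.le q)
      _ = ε i ^ i * (c ^ q * ε q ^ q) := by ring
      _ ≤ ε i ^ i * (M * (ρ - r) ^ q) :=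
          mul_le_mul_of_nonneg_left (hM q) (pow_nonneg (hε' i) i)
      _ = M * ε i ^ i * (ρ - r) ^ q := by ring
  refine lt_of_le_of_lt ?_ (ENNReal.mul_lt_top (ENNReal.ofReal_lt_top (r := M)) hsum)
  rw [ENNReal.tsum_prod', ENNReal.tsum_prod', ← ENNReal.tsum_mul_left]
  refine ENNReal.tsum_le_tsum fun i => ?_
  calc ∑' p : ℕ × ℕ, (‖a i (p.1 + p.2)‖₊ : ℝ≥0∞) * (Nat.choose (p.1 + p.2) p.1 : ℝ≥0∞) *
          ENNReal.ofReal (r ^ p.1) * ENNReal.ofReal (c ^ p.2) *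
          ENNReal.ofReal (ε (i + p.2) ^ (i + p.2))
      ≤ ∑' p : ℕ × ℕ, (ENNReal.ofReal M * ENNReal.ofReal (ε i ^ i) * ‖a i (p.1 + p.2)‖₊) *
          ((Nat.choose (p.1 + p.2) p.1 : ℝ≥0∞) *
            (ENNReal.ofReal r ^ p.1 * ENNReal.ofReal (ρ - r) ^ p.2)) := by
        refine ENNReal.tsum_le_tsum fun p => ?_
        rw [mul_assoc _ (ENNReal.ofReal (c ^ p.2)), ENNReal.ofReal_pow hr.le]
        refine (mul_le_mul_right (hterm i p.2) _).trans_eq ?_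
        ring
    _ = ∑' n, (ENNReal.ofReal M * ENNReal.ofReal (ε i ^ i) * ‖a i n‖₊) * ENNReal.ofReal ρ ^ n := by
        rw [ENNReal.tsum_mul_choose_mul_pow_mul_pow
          (fun n => ENNReal.ofReal M * ENNReal.ofReal (ε i ^ i) * ‖a i n‖₊), hadd]
    _ = ENNReal.ofReal M * ∑' n, (‖a i n‖₊ : ℝ≥0∞) * ENNReal.ofReal (ρ ^ n) *
          ENNReal.ofReal (ε i ^ i) := by
        rw [← ENNReal.tsum_mul_left]
        refine tsum_congr fun n => ?_
        rw [ENNReal.ofReal_pow hρ.le]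
        ring
end

section
/- Let S > 0 and let N : (0,S] → (0,∞) be twice differentiable with N'(x) ≥ 0 and N'(x)²/N(x) − N''(x) − N'(x)/x ≥ 0 for all x ∈ (0,S]. Let h : (0,∞) → (0,S] be twice differentiable with h(r) > 0 and h'(r)² ≥ h(r)·h''(r) for all r > 0. Then (d²/dr²) log N(h(r)) ≤ 0 for all r > 0; that is, the function r ↦ log N(h(r)) is concave on (0,∞). (This is the analytic core of Lemma 5.4: under the subharmonicity condition on the weights and the condition h'² ≥ h·h'' on the level function, the function W_j(z) = −2 log ‖t^j‖_{h(r)} is plurisubharmonic.) -/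
open Set

/-- Second derivative of `log ∘ N ∘ h` at a point near which `N ∘ h` does not vanish. -/
lemma deriv_deriv_log_comp {N h : ℝ → ℝ} (hN1 : Differentiable ℝ N)
    (hN2 : Differentiable ℝ (deriv N)) (hh1 : Differentiable ℝ h)
    (hh2 : Differentiable ℝ (deriv h)) {r : ℝ} (hr : N (h r) ≠ 0) :
    deriv (deriv fun s => Real.log (N (h s))) r =
      ((deriv (deriv N) (h r) * deriv h r * deriv h r + deriv N (h r) * deriv (deriv h) r) *
        N (h r) - deriv N (h r) * deriv h r * (deriv N (h r) * deriv h r)) / N (h r) ^ 2 := by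
  have hNh (s : ℝ) : HasDerivAt (fun s => N (h s)) (deriv N (h s) * deriv h s) s :=
    (hN1 (h s)).hasDerivAt.comp s (hh1 s).hasDerivAt
  have hlog : deriv (fun s => Real.log (N (h s))) =ᶠ[nhds r]
      fun s => deriv N (h s) * deriv h s / N (h s) := by
    filter_upwards [(hNh r).continuousAt.eventually_ne hr] with s hs
    exact ((hNh s).log hs).deriv
  rw [hlog.deriv_eq]
  have hN' : HasDerivAt (fun s => deriv N (h s)) (deriv (deriv N) (h r) * deriv h r) r :=
    (hN2 (h r)).hasDerivAt.comp r (hh1 r).hasDerivAt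
  exact ((hN'.mul (hh2 r).hasDerivAt).div (hNh r) hr).deriv

/-- The analytic core of Lemma 5.4: if `N` is positive, nondecreasing and satisfies the
subharmonicity condition `(N')²/N − N'' − N'/x ≥ 0` on `(0,S]`, and the level function
`h` maps `(0,∞)` into `(0,S]` and satisfies `h'(r)² ≥ h(r)·h''(r)`, then
`(d²/dr²) log N(h(r)) ≤ 0` for all `r > 0`, i.e. `r ↦ log N(h(r))` is concave;
hence `W_j(z) = −2 log ‖tʲ‖_{h(r)}` is plurisubharmonic. -/
theorem stmt10 (S : ℝ) (hS : 0 < S) (N : ℝ → ℝ)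
    (hN1 : Differentiable ℝ N) (hN2 : Differentiable ℝ (deriv N))
    (hNpos : ∀ x ∈ Ioc 0 S, 0 < N x)
    (hNmono : ∀ x ∈ Ioc 0 S, 0 ≤ deriv N x)
    (hNsub : ∀ x ∈ Ioc 0 S,
      (deriv N x) ^ 2 / N x - deriv (deriv N) x - deriv N x / x ≥ 0)
    (h : ℝ → ℝ) (hh1 : Differentiable ℝ h) (hh2 : Differentiable ℝ (deriv h))
    (hrange : ∀ r : ℝ, 0 < r → h r ∈ Ioc 0 S)
    (hcond : ∀ r : ℝ, 0 < r → (deriv h r) ^ 2 ≥ h r * deriv (deriv h) r) :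
    ∀ r : ℝ, 0 < r → deriv (deriv fun s => Real.log (N (h s))) r ≤ 0 := by
  intro r hr
  obtain ⟨hpos, -⟩ := hrange r hr
  have hN := hNpos _ (hrange r hr)
  have hN' := hNmono _ (hrange r hr)
  have hsub := hNsub _ (hrange r hr)
  have hc := hcond r hr
  rw [deriv_deriv_log_comp hN1 hN2 hh1 hh2 hN.ne']
  refine div_nonpos_of_nonpos_of_nonneg ?_ (sq_nonneg _)
  have hh'' : deriv (deriv h) r ≤ deriv h r ^ 2 / h r := by
    rw [le_div_iff₀ hpos]
    linarith
  have hN'' : deriv (deriv N) (h r) ≤ deriv N (h r) ^ 2 / N (h r) - deriv N (h r) / h r := by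
    linarith
  have key : deriv (deriv N) (h r) * deriv h r ^ 2 + deriv N (h r) * deriv (deriv h) r ≤
      deriv N (h r) ^ 2 * deriv h r ^ 2 / N (h r) :=
    calc
      _ ≤ (deriv N (h r) ^ 2 / N (h r) - deriv N (h r) / h r) * deriv h r ^ 2 +
          deriv N (h r) * (deriv h r ^ 2 / h r) := by gcongr
      _ = _ := by ring
  rw [le_div_iff₀ hN] at key
  linarith
end

section
/- Let (s_i)_{i∈ℤ} be a family of entire functions ℂ → ℂ such that s_i(z) = s_{i−n}(z − n) for all i, n ∈ ℤ and all z ∈ ℂ, and such that for every z ∈ ℂ the set {i ∈ ℤ : s_i(z) ≠ 0} is finite. Then s_i is identically zero for every i ∈ ℤ. (This is the core of Example 2: for A = ℂ[t,t⁻¹] with the ℤ-action (n·f)(t) = tⁿ f(t−n), the ℤ-invariant global sections Γ(ℂ, 𝒜_ℂ)^ℤ = Γ(ℂ/ℤ, 𝒜_ℂ/ℤ) vanish, so the induced locally free, hence coherent, sheaf on X = ℂ/ℤ has no nonzero global sections and Cartan's Theorem A fails for the non-local ring A = ℂ[t,t⁻¹].) -/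
/-- Core of Example 2 (failure of Cartan A for the non-local ring `A = ℂ[t,t⁻¹]` on
`X = ℂ/ℤ`): if a family of entire functions `(s_i)_{i∈ℤ}` (the `t^i`-coefficients of a
holomorphic function `ℂ → ℂ[t,t⁻¹]`) satisfies the ℤ-equivariance relations
`s_i(z) = s_{i−n}(z−n)` and at each point only finitely many `s_i` are nonzero, then
all the `s_i` vanish identically; hence `Γ(ℂ, 𝒜_ℂ)^ℤ = 0`. -/
theorem stmt16 (s : ℤ → ℂ → ℂ) (hent : ∀ i : ℤ, Differentiable ℂ (s i))
    (hequiv : ∀ (i n : ℤ) (z : ℂ), s i z = s (i - n) (z - (n : ℂ)))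
    (hfin : ∀ z : ℂ, {i : ℤ | s i z ≠ 0}.Finite) :
    ∀ (i : ℤ) (z : ℂ), s i z = 0 := by
  -- By Baire, the zero set of some `s k` has nonempty interior, as every `z` is a zero of some `s k`.
  obtain ⟨k, z₀, hz₀⟩ : ∃ k, (interior {z | s k z = 0}).Nonempty := by
    refine nonempty_interior_of_iUnion_of_closed
      (fun k => isClosed_eq (hent k).continuous continuous_const) ?_
    refine Set.eq_univ_of_forall fun z => ?_
    obtain ⟨k, hk⟩ := (hfin z).exists_notMem
    exact Set.mem_iUnion.2 ⟨k, not_not.1 hk⟩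
  have hk : s k = 0 :=
    AnalyticOnNhd.eq_of_eventuallyEq (fun z _ => (hent k).analyticAt z) analyticOnNhd_const
      (mem_interior_iff_mem_nhds.1 hz₀)
  intro i z
  rw [hequiv i (i - k) z, sub_sub_cancel, hk, Pi.zero_apply]
end
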